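/- arXiv:2104.00748 — 3 statements merged into one kernel-verified Lean document; each statement's English description precedes it below -/
import Mathlib

section
/- Fix n ≥ 1, a point x⁰ ∈ ℝⁿ, and positive reals Δ₁,…,Δ_n with Δ = Δ₁⋯Δ_n. Let f : ℝⁿ → ℝ be continuous on an open set containing the hyperrectangle R(x⁰;d) = {x⁰ + x : 0 ≤ x_i ≤ Δ_i for all i}. For each choice of integers N₁,…,N_n ≥ 2, set Δ̄_i = Δ_i/N_i, N = N₁⋯N_n, and for each multi-index k with 1 ≤ k_i ≤ N_i choose s(k) ∈ ℝⁿ with (k_i−1)Δ̄_i ≤ s(k)_i ≤ k_iΔ̄_i; let S ∈ ℝ^{n×N} be the matrix with columns s(k) and define the generalized simplex gradient ∇_s f(x⁰;S) = (S Sᵀ)⁻¹ S δ_f(x⁰;S), where δ_f(x⁰;S) ∈ ℝᴺ has entries f(x⁰ + s(k)) − f(x⁰). Then, as all N₁,…,N_n tend to infinity, ∇_s f(x⁰;S) converges to Δ⁻¹ · L_n · T_n, where L_n ∈ ℝ^{n×n} has entries [L_n]_{i,i} = 12(3n−2)/(Δ_i²(3n+1)) and [L_n]_{i,j} = −36/(Δ_iΔ_j(3n+1))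 for i ≠ j, and T_n ∈ ℝⁿ has components [T_n]_i = ∫_{R(0;d)} x_i (f(x⁰+x) − f(x⁰)) dx over the box R(0;d) = ∏_{i=1}^n [0, Δ_i]. -/
open scoped BigOperators

noncomputable section

/-- Interpret a plain vector in `Fin n → ℝ` as an element of Euclidean space,
so that `‖·‖` is the Euclidean norm. -/
def vecE {n : ℕ} (v : Fin n → ℝ) : EuclideanSpace ℝ (Fin n) :=
  (EuclideanSpace.equiv (Fin n) ℝ).symm v

/-- The box `R(0;d) = ∏ᵢ [0, Δᵢ]` in Euclidean space. -/
def box {n : ℕ} (Δ : Fin n → ℝ) : Set (EuclideanSpace ℝ (Fin n)) :=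
  {x | ∀ l, x l ∈ Set.Icc (0 : ℝ) (Δ l)}

/-- Admissibility: the point `s(k)` lies in the sub-hyperrectangle indexed by `k`. -/
def Admissible {n : ℕ} (Δ : Fin n → ℝ) (Nv : Fin n → ℕ)
    (s : ((i : Fin n) → Fin (Nv i)) → Fin n → ℝ) : Prop :=
  ∀ k i, (k i : ℝ) * (Δ i / (Nv i : ℝ)) ≤ s k i ∧
    s k i ≤ ((k i : ℝ) + 1) * (Δ i / (Nv i : ℝ))

/-- The matrix `S` whose columns are the chosen sample directions `s(k)`. -/
def Smat {n : ℕ} (Nv : Fin n → ℕ) (s : ((i : Fin n) → Fin (Nv i)) → Fin n → ℝ) :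
    Matrix (Fin n) ((i : Fin n) → Fin (Nv i)) ℝ :=
  Matrix.of fun i k => s k i

/-- The limit matrix `Lₙ`. -/
def Lmat (n : ℕ) (Δ : Fin n → ℝ) : Matrix (Fin n) (Fin n) ℝ :=
  Matrix.of fun i j =>
    if i = j then 12 * (3 * (n : ℝ) - 2) / ((Δ i) ^ 2 * (3 * (n : ℝ) + 1))
    else -36 / (Δ i * Δ j * (3 * (n : ℝ) + 1))

open Filter MeasureTheory Set Topology

/-- The filter of sample families: all the grid sizes tend to infinity, while the sample points
range over all admissible choices. -/
def sampleFilter {n : ℕ} (Δ : Fin n → ℝ) :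
    Filter (Σ Nv : Fin n → ℕ, ((i : Fin n) → Fin (Nv i)) → Fin n → ℝ) :=
  comap Sigma.fst atTop ⊓ 𝓟 {p | Admissible Δ p.1 p.2}

/-- The half-open cell with side lengths `h` and multi-index `k`. -/
def gridCell {n : ℕ} (h : Fin n → ℝ) {Nv : Fin n → ℕ} (k : (i : Fin n) → Fin (Nv i)) :
    Set (Fin n → ℝ) :=
  univ.pi fun i => Ico ((k i : ℝ) * h i) (((k i : ℝ) + 1) * h i)

lemma measurableSet_gridCell {n : ℕ} (h : Fin n → ℝ) {Nv : Fin n → ℕ}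
    (k : (i : Fin n) → Fin (Nv i)) : MeasurableSet (gridCell h k) :=
  MeasurableSet.univ_pi fun _ => measurableSet_Ico

lemma volume_real_gridCell {n : ℕ} {h : Fin n → ℝ} (hh : ∀ i, 0 ≤ h i) {Nv : Fin n → ℕ}
    (k : (i : Fin n) → Fin (Nv i)) : volume.real (gridCell h k) = ∏ i, h i := by
  rw [Measure.real, gridCell, Real.volume_pi_Ico_toReal fun i => by
    dsimp only; nlinarith [hh i]]
  exact Finset.prod_congr rfl fun i _ => by ring

lemma volume_gridCell_lt_top {n : ℕ} (h : Fin n → ℝ) {Nv : Fin n → ℕ}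
    (k : (i : Fin n) → Fin (Nv i)) : volume (gridCell h k) < ⊤ := by
  rw [gridCell, Real.volume_pi_Ico]
  exact ENNReal.prod_lt_top fun _ _ => ENNReal.ofReal_lt_top

lemma floor_eq_of_mem_Ico_mul {a x : ℝ} (ha : 0 < a) {j : ℕ}
    (hx : x ∈ Ico ((j : ℝ) * a) (((j : ℝ) + 1) * a)) : ⌊x / a⌋₊ = j := by
  have h0 : 0 ≤ x / a := div_nonneg (le_trans (by positivity) hx.1) ha.le
  rw [Nat.floor_eq_iff h0, le_div_iff₀ ha, div_lt_iff₀ ha]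
  exact hx

lemma pairwise_disjoint_gridCell {n : ℕ} {h : Fin n → ℝ} (hh : ∀ i, 0 < h i) (Nv : Fin n → ℕ) :
    Pairwise (Function.onFun Disjoint fun k : (i : Fin n) → Fin (Nv i) => gridCell h k) := by
  intro k l hkl
  refine Set.disjoint_left.2 fun x hk hl => hkl (funext fun i => Fin.ext ?_)
  rw [← floor_eq_of_mem_Ico_mul (hh i) (hk i (mem_univ i)),
    ← floor_eq_of_mem_Ico_mul (hh i) (hl i (mem_univ i))]

lemma iUnion_Ico_mul {a : ℝ} (ha : 0 < a) (N : ℕ) :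
    ⋃ j : Fin N, Ico ((j : ℝ) * a) (((j : ℝ) + 1) * a) = Ico 0 (N * a) := by
  ext x
  simp only [mem_iUnion]
  constructor
  · rintro ⟨j, hj⟩
    have hjN : (j : ℝ) + 1 ≤ N := by exact_mod_cast j.2
    exact ⟨le_trans (by positivity) hj.1, hj.2.trans_le (by gcongr)⟩
  · rintro ⟨h0, hN⟩
    have hxa : 0 ≤ x / a := div_nonneg h0 ha.le
    refine ⟨⟨⌊x / a⌋₊, (Nat.floor_lt hxa).2 ((div_lt_iff₀ ha).2 hN)⟩, ?_, ?_⟩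
    · exact (le_div_iff₀ ha).1 (Nat.floor_le hxa)
    · exact (div_lt_iff₀ ha).1 (Nat.lt_floor_add_one _)

lemma iUnion_gridCell {n : ℕ} {h : Fin n → ℝ} (hh : ∀ i, 0 < h i) (Nv : Fin n → ℕ) :
    ⋃ k : (i : Fin n) → Fin (Nv i), gridCell h k = univ.pi fun i => Ico 0 (Nv i * h i) := by
  simp only [gridCell]
  rw [iUnion_univ_pi fun i (j : Fin (Nv i)) => Ico ((j : ℝ) * h i) (((j : ℝ) + 1) * h i)]
  simp only [iUnion_Ico_mul (hh _)]

/-- If `g` varies by at most `C` between each sample point and the points of its cell, then the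
Riemann sum of `g` is within `C` times the volume of the box of the integral of `g`. -/
lemma abs_riemannSum_sub_integral_le {n : ℕ} {h : Fin n → ℝ} (hh : ∀ i, 0 < h i)
    {Nv : Fin n → ℕ} {s : ((i : Fin n) → Fin (Nv i)) → Fin n → ℝ} {g : (Fin n → ℝ) → ℝ}
    (hg : IntegrableOn g (Icc 0 fun i => Nv i * h i)) {C : ℝ}
    (hC : ∀ k, ∀ x ∈ gridCell h k, |g (s k) - g x| ≤ C) :
    |(∏ i, h i) * ∑ k, g (s k) - ∫ x in Icc 0 fun i => Nv i * h i, g x|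
      ≤ C * ∏ i, (Nv i * h i) := by
  have hae : (univ.pi fun i => Ico (0 : ℝ) (Nv i * h i)) =ᵐ[volume]
      Icc (0 : Fin n → ℝ) fun i => Nv i * h i := Measure.univ_pi_Ico_ae_eq_Icc
  have hgu : IntegrableOn g (⋃ k : (i : Fin n) → Fin (Nv i), gridCell h k) := by
    rw [iUnion_gridCell hh]
    exact hg.congr_set_ae hae
  have hgk (k : (i : Fin n) → Fin (Nv i)) : IntegrableOn g (gridCell h k) :=
    hgu.mono_set (subset_iUnion _ k)
  have hcell (k : (i : Fin n) → Fin (Nv i)) :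
      |(∏ i, h i) * g (s k) - ∫ x in gridCell h k, g x| ≤ C * ∏ i, h i := by
    have hconst : (∏ i, h i) * g (s k) = ∫ _ in gridCell h k, g (s k) := by
      rw [setIntegral_const, volume_real_gridCell fun i => (hh i).le, smul_eq_mul]
    have hint : IntegrableOn (fun _ => g (s k)) (gridCell h k) :=
      integrableOn_const (volume_gridCell_lt_top h k).ne
    rw [hconst, ← integral_sub hint (hgk k), ← Real.norm_eq_abs,
      ← volume_real_gridCell (fun i => (hh i).le) k]
    exact norm_setIntegral_le_of_norm_le_const (volume_gridCell_lt_top h k) (hC k)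
  rw [← setIntegral_congr_set hae, ← iUnion_gridCell hh,
    integral_iUnion_fintype (measurableSet_gridCell h) (pairwise_disjoint_gridCell hh Nv) hgk,
    Finset.mul_sum, ← Finset.sum_sub_distrib]
  refine (Finset.abs_sum_le_sum_abs _ _).trans ((Finset.sum_le_sum fun k _ => hcell k).trans ?_)
  rw [Finset.sum_const, Finset.card_univ, Fintype.card_pi, Finset.prod_mul_distrib, nsmul_eq_mul]
  simp only [Fintype.card_fin, Nat.cast_prod]
  exact le_of_eq (by ring)

lemma eventually_sampleFilter_div_lt {n : ℕ} (Δ : Fin n → ℝ) {δ : ℝ} (hδ : 0 < δ) :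
    ∀ᶠ p in sampleFilter Δ, Admissible Δ p.1 p.2 ∧ ∀ i, 0 < p.1 i ∧ Δ i / p.1 i < δ := by
  choose m hm using fun i => exists_nat_gt (Δ i / δ)
  have hN : ∀ᶠ p in sampleFilter Δ, (fun i => m i + 1) ≤ p.1 :=
    ((eventually_ge_atTop _).comap Sigma.fst).filter_mono inf_le_left
  have hA : ∀ᶠ p in sampleFilter Δ, Admissible Δ p.1 p.2 :=
    (eventually_principal.2 fun _ h => h).filter_mono inf_le_right
  filter_upwards [hN, hA] with p hp hpA
  refine ⟨hpA, fun i => ?_⟩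
  have hpos : 0 < p.1 i := (Nat.succ_pos _).trans_le (hp i)
  have hcast : (m i : ℝ) ≤ p.1 i := by exact_mod_cast (Nat.le_succ _).trans (hp i)
  refine ⟨hpos, ?_⟩
  rw [div_lt_comm₀ (by exact_mod_cast hpos) hδ]
  exact (hm i).trans_le hcast

/-- Riemann sums of a continuous function on a box converge to its integral, uniformly in the
choice of the sample points. -/
lemma tendsto_riemannSum {n : ℕ} {Δ : Fin n → ℝ} (hΔ : ∀ i, 0 < Δ i) {g : (Fin n → ℝ) → ℝ}
    (hg : ContinuousOn g (Icc 0 Δ)) :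
    Tendsto (fun p : Σ Nv : Fin n → ℕ, ((i : Fin n) → Fin (Nv i)) → Fin n → ℝ =>
        (∏ i, Δ i / p.1 i) * ∑ k, g (p.2 k))
      (sampleFilter Δ) (𝓝 (∫ x in Icc 0 Δ, g x)) := by
  rw [Metric.tendsto_nhds]
  intro ε hε
  have hV : 0 < ∏ i, Δ i := Finset.prod_pos fun i _ => hΔ i
  obtain ⟨δ, hδ, huc⟩ := Metric.uniformContinuousOn_iff.1
    (isCompact_Icc.uniformContinuousOn_of_continuous hg) (ε / (2 * ∏ i, Δ i)) (by positivity)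
  filter_upwards [eventually_sampleFilter_div_lt Δ hδ] with ⟨Nv, s⟩ ⟨hs, hN⟩
  dsimp only at hs hN ⊢
  have hNpos (i) : (0 : ℝ) < Nv i := by exact_mod_cast (hN i).1
  have hside : (fun i => Nv i * (Δ i / Nv i)) = Δ :=
    funext fun i => mul_div_cancel₀ _ (hNpos i).ne'
  have hh (i) : 0 < Δ i / Nv i := div_pos (hΔ i) (hNpos i)
  have hmem {k : (i : Fin n) → Fin (Nv i)} {x : Fin n → ℝ}
      (hx : ∀ i, (k i : ℝ) * (Δ i / Nv i) ≤ x i ∧ x i ≤ ((k i : ℝ) + 1) * (Δ i / Nv i)) :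
      x ∈ Icc 0 Δ := by
    refine ⟨fun i => le_trans ?_ (hx i).1, fun i => (hx i).2.trans ?_⟩
    · have := (hh i).le
      simp only [Pi.zero_apply]
      positivity
    · have hk : (k i : ℝ) + 1 ≤ Nv i := by exact_mod_cast (k i).2
      exact (mul_le_mul_of_nonneg_right hk (hh i).le).trans_eq (congrFun hside i)
  have hosc : ∀ k, ∀ x ∈ gridCell (fun i => Δ i / Nv i) k,
      |g (s k) - g x| ≤ ε / (2 * ∏ i, Δ i) := by
    intro k x hx
    have hx' (i) := hx i (mem_univ i)
    refine (huc (s k) (hmem (hs k)) x (hmem fun i => ⟨(hx' i).1, (hx' i).2.le⟩) ?_).le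
    rw [dist_pi_lt_iff hδ]
    intro i
    refine lt_of_le_of_lt ?_ (hN i).2
    have h1 := hs k i
    have h2 := hx' i
    rw [Real.dist_eq, abs_le]
    constructor <;> linarith [h1.1, h1.2, h2.1, h2.2]
  have key := abs_riemannSum_sub_integral_le hh (g := g) (s := s)
    (by rw [hside]; exact hg.integrableOn_compact isCompact_Icc) hosc
  simp only [congrFun hside] at key
  rw [Real.dist_eq]
  refine key.trans_lt ?_
  rw [div_mul_eq_mul_div, div_lt_iff₀ (by positivity)]
  nlinarith

lemma setIntegral_Icc_prod_eq {n : ℕ} (Δ : Fin n → ℝ) (φ : Fin n → ℝ → ℝ) :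
    ∫ x in Icc 0 Δ, ∏ l, φ l (x l) = ∏ l, ∫ t in Icc 0 (Δ l), φ l t := by
  rw [← pi_univ_Icc, volume_pi, Measure.restrict_pi_pi, integral_fintype_prod_eq_prod]
  rfl

lemma setIntegral_Icc_zero_eq {a : ℝ} (ha : 0 < a) (φ : ℝ → ℝ) :
    ∫ t in Icc 0 a, φ t = ∫ t in 0..a, φ t := by
  rw [integral_Icc_eq_integral_Ioc, intervalIntegral.integral_of_le ha.le]

/-- The second moments of the box. -/
lemma setIntegral_Icc_mul {n : ℕ} {Δ : Fin n → ℝ} (hΔ : ∀ i, 0 < Δ i) (i j : Fin n) :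
    ∫ x in Icc 0 Δ, x i * x j =
      (∏ l, Δ l) * (Δ i * Δ j * (1 / 4 + if i = j then 1 / 12 else 0)) := by
  have hprod (x : Fin n → ℝ) : x i * x j =
      ∏ l, ((if l = i then x l else 1) * if l = j then x l else 1) := by
    rw [Finset.prod_mul_distrib]
    simp
  simp_rw [hprod]
  rw [setIntegral_Icc_prod_eq Δ
    fun l t => (if l = i then t else 1) * if l = j then t else 1]
  have hfactor (l) : ∫ t in Icc 0 (Δ l), (if l = i then t else 1) * (if l = j then t else 1) =
      Δ l * ((if l = i then Δ l / 2 else 1) * (if l = j then Δ l / 2 else 1) *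
        if l = i then if i = j then 4 / 3 else 1 else 1) := by
    rw [setIntegral_Icc_zero_eq (hΔ l)]
    by_cases hi : l = i
    · subst hi
      by_cases hj : l = j
      · simp only [if_pos hj, if_true, ← pow_two, integral_pow]
        norm_num
        ring
      · simp [hj]
        ring
    · by_cases hj : l = j
      · have hji : ¬j = i := hj ▸ hi
        simp [hj, hji]
        ring
      · simp [hi, hj]
  simp_rw [hfactor, Finset.prod_mul_distrib, Finset.prod_ite_eq' Finset.univ,
    Finset.mem_univ, if_true]
  split_ifs <;> ring

/-- The limit of the rescaled Gram matrices `S Sᵀ`. -/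
def gramLimit {n : ℕ} (Δ : Fin n → ℝ) : Matrix (Fin n) (Fin n) ℝ :=
  Matrix.of fun i j => ∫ x in Icc 0 Δ, x i * x j

lemma Lmat_mul_gramLimit {n : ℕ} {Δ : Fin n → ℝ} (hΔ : ∀ i, 0 < Δ i) :
    ((∏ l, Δ l)⁻¹ • Lmat n Δ) * gramLimit Δ = 1 := by
  have hV : (∏ l, Δ l) ≠ 0 := (Finset.prod_pos fun i _ => hΔ i).ne'
  have hn : (3 * (n : ℝ) + 1) ≠ 0 := by positivity
  ext i j
  have hterm (k) : Lmat n Δ i k * (Δ k * Δ j * (1 / 4 + if k = j then 1 / 12 else 0)) =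
      Δ j / Δ i * ((if i = k then 12 * (1 / 4 + if k = j then 1 / 12 else 0) else 0)
        - 9 / (3 * (n : ℝ) + 1) - if k = j then 3 / (3 * (n : ℝ) + 1) else 0) := by
    have := (hΔ i).ne'
    have := (hΔ k).ne'
    simp only [Lmat, Matrix.of_apply]
    split_ifs with h1 h2 h2
    all_goals
      try subst h1
      field_simp
      ring
  have hentry (k) : ((∏ l, Δ l)⁻¹ • Lmat n Δ) i k * gramLimit Δ k j =
      Lmat n Δ i k * (Δ k * Δ j * (1 / 4 + if k = j then 1 / 12 else 0)) := by
    rw [gramLimit, Matrix.of_apply, setIntegral_Icc_mul hΔ, Matrix.smul_apply, smul_eq_mul]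
    field_simp
  rw [Matrix.mul_apply, Matrix.one_apply]
  simp_rw [hentry, hterm, ← Finset.mul_sum, Finset.sum_sub_distrib,
    Finset.sum_ite_eq, Finset.sum_ite_eq', Finset.mem_univ, if_true, Finset.sum_const,
    Finset.card_univ, Fintype.card_fin, nsmul_eq_mul]
  have := (hΔ i).ne'
  split_ifs with h
  · subst h
    field_simp
    ring
  · field_simp
    ring

lemma tendsto_gram {n : ℕ} {Δ : Fin n → ℝ} (hΔ : ∀ i, 0 < Δ i) :
    Tendsto (fun p : Σ Nv : Fin n → ℕ, ((i : Fin n) → Fin (Nv i)) → Fin n → ℝ =>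
        (∏ i, Δ i / p.1 i) • (Smat p.1 p.2 * (Smat p.1 p.2).transpose))
      (sampleFilter Δ) (𝓝 (gramLimit Δ)) := by
  refine tendsto_pi_nhds.2 fun i => tendsto_pi_nhds.2 fun j => ?_
  simpa [gramLimit, Smat, Matrix.mul_apply] using
    tendsto_riemannSum hΔ (g := fun x => x i * x j) (by fun_prop)

lemma tendsto_smul_Smat_mulVec {n : ℕ} {Δ : Fin n → ℝ} (hΔ : ∀ i, 0 < Δ i)
    {g : (Fin n → ℝ) → ℝ} (hg : ContinuousOn g (Icc 0 Δ)) :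
    Tendsto (fun p : Σ Nv : Fin n → ℕ, ((i : Fin n) → Fin (Nv i)) → Fin n → ℝ =>
        (∏ i, Δ i / p.1 i) • (Smat p.1 p.2).mulVec fun k => g (p.2 k))
      (sampleFilter Δ) (𝓝 fun i => ∫ x in Icc 0 Δ, x i * g x) := by
  refine tendsto_pi_nhds.2 fun i => ?_
  simpa [Smat, Matrix.mulVec, dotProduct] using
    tendsto_riemannSum hΔ (g := fun x => x i * g x) (by fun_prop)

/-- The sample regression coefficients `(S Sᵀ)⁻¹ S g` converge along `sampleFilter`. -/
lemma tendsto_simplexGradient {n : ℕ} {Δ : Fin n → ℝ} (hΔ : ∀ i, 0 < Δ i)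
    {g : (Fin n → ℝ) → ℝ} (hg : ContinuousOn g (Icc 0 Δ)) :
    Tendsto (fun p : Σ Nv : Fin n → ℕ, ((i : Fin n) → Fin (Nv i)) → Fin n → ℝ =>
        ((Smat p.1 p.2 * (Smat p.1 p.2).transpose)⁻¹ * Smat p.1 p.2).mulVec fun k => g (p.2 k))
      (sampleFilter Δ)
      (𝓝 ((∏ l, Δ l)⁻¹ • (Lmat n Δ).mulVec fun i => ∫ x in Icc 0 Δ, x i * g x)) := by
  have hinv := Matrix.inv_eq_left_inv (Lmat_mul_gramLimit hΔ)
  have hdet : (gramLimit Δ).det ≠ 0 :=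
    (Matrix.isUnit_det_of_left_inverse (Lmat_mul_gramLimit hΔ)).ne_zero
  have hcont : ContinuousAt Inv.inv (gramLimit Δ) :=
    continuousAt_matrix_inv _ (by
      rw [Ring.inverse_eq_inv']
      exact continuousAt_inv₀ hdet)
  have hlim := (continuous_fst.matrix_mulVec continuous_snd).tendsto
    ((gramLimit Δ)⁻¹, fun i => ∫ x in Icc 0 Δ, x i * g x)
  have key := hlim.comp
    ((hcont.tendsto.comp (tendsto_gram hΔ)).prodMk_nhds (tendsto_smul_Smat_mulVec hΔ hg))
  rw [hinv, Matrix.smul_mulVec] at key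
  refine key.congr' ?_
  filter_upwards [eventually_sampleFilter_div_lt Δ one_pos] with p hp
  have hv : (∏ i, Δ i / p.1 i) ≠ 0 :=
    (Finset.prod_pos fun i _ => div_pos (hΔ i) (by exact_mod_cast (hp.2 i).1)).ne'
  have hsmul (A : Matrix (Fin n) (Fin n) ℝ) :
      ((∏ i, Δ i / p.1 i) • A)⁻¹ = (∏ i, Δ i / p.1 i)⁻¹ • A⁻¹ := by
    by_cases hA : IsUnit A.det
    · exact Matrix.inv_smul' A (Units.mk0 _ hv) hA
    · rw [Matrix.nonsing_inv_apply_not_isUnit _ hA, Matrix.nonsing_inv_apply_not_isUnit, smul_zero]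
      rw [Matrix.det_smul]
      exact fun h => hA (isUnit_of_mul_isUnit_right h)
  simp only [Function.comp_apply, hsmul, Matrix.mulVec_smul, Matrix.mulVec_mulVec,
    Matrix.smul_mul, Matrix.smul_mulVec]
  rw [smul_smul, mul_inv_cancel₀ hv, one_smul]

lemma setIntegral_box_eq {n : ℕ} (Δ : Fin n → ℝ) (F : EuclideanSpace ℝ (Fin n) → ℝ) :
    ∫ x in box Δ, F x = ∫ x in Icc 0 Δ, F (vecE x) := by
  have hbox : Icc 0 Δ = (WithLp.toLp 2 : (Fin n → ℝ) → _) ⁻¹' box Δ := by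
    ext x
    simp [box, Pi.le_def, forall_and]
  rw [hbox]
  exact ((PiLp.volume_preserving_toLp (Fin n)).setIntegral_preimage_emb
    (MeasurableEquiv.toLp 2 (Fin n → ℝ)).measurableEmbedding F (box Δ)).symm

/-- Theorem 3.10 of the paper: the generalized simplex gradient
`∇ₛf(x⁰;S) = (SSᵀ)⁻¹Sδ_f(x⁰;S)` converges to `Δ⁻¹·Lₙ·Tₙ` as all `Nᵢ → ∞`,
uniformly over the admissible choices of sample points. -/
theorem gsg_tendsto_limit
    (n : ℕ) (hn : 1 ≤ n)
    (x0 : EuclideanSpace ℝ (Fin n))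
    (Δ : Fin n → ℝ) (hΔ : ∀ i, 0 < Δ i)
    (f : EuclideanSpace ℝ (Fin n) → ℝ)
    (U : Set (EuclideanSpace ℝ (Fin n))) (hU : IsOpen U)
    (hsub : {y : EuclideanSpace ℝ (Fin n) | ∀ l, y l - x0 l ∈ Set.Icc (0 : ℝ) (Δ l)} ⊆ U)
    (hf : ContinuousOn f U) :
    ∀ ε : ℝ, 0 < ε → ∃ M : ℕ, ∀ (Nv : Fin n → ℕ), (∀ i, 2 ≤ Nv i) →
      (∀ i, M ≤ Nv i) →
      ∀ s : ((i : Fin n) → Fin (Nv i)) → Fin n → ℝ, Admissible Δ Nv s →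
        ‖vecE (Matrix.mulVec ((Smat Nv s * (Smat Nv s).transpose)⁻¹ * Smat Nv s)
              (fun k => f (x0 + vecE (s k)) - f x0))
          - vecE ((∏ l, Δ l)⁻¹ •
              Matrix.mulVec (Lmat n Δ)
                (fun j => ∫ x in box Δ, x j * (f (x0 + x) - f x0)))‖ < ε := by
  intro ε hε
  have hvec : Continuous (vecE : (Fin n → ℝ) → _) :=
    (EuclideanSpace.equiv (Fin n) ℝ).symm.continuous
  have hg : ContinuousOn (fun x => f (x0 + vecE x) - f x0) (Icc 0 Δ) := by
    refine ContinuousOn.sub (hf.comp (by fun_prop) fun x hx => hsub fun l => ?_) continuousOn_const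
    simpa [vecE] using ⟨hx.1 l, hx.2 l⟩
  have key := (hvec.tendsto _).comp (tendsto_simplexGradient hΔ hg)
  have hev := Metric.tendsto_nhds.1 key ε hε
  rw [sampleFilter, eventually_inf_principal, eventually_comap, eventually_atTop] at hev
  obtain ⟨m, hm⟩ := hev
  refine ⟨∑ i, m i, fun Nv _ hM s hs => ?_⟩
  have hmN : m ≤ Nv := fun i =>
    (Finset.single_le_sum (fun _ _ => Nat.zero_le _) (Finset.mem_univ i)).trans (hM i)
  have := hm Nv hmN ⟨Nv, s⟩ rfl hs
  simp only [setIntegral_box_eq]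
  rwa [dist_eq_norm] at this

end
end

section
/- Fix n ≥ 1, a point x⁰ ∈ ℝⁿ, and positive reals Δ₁,…,Δ_n. Let Δ = Δ₁⋯Δ_n, Δ_S = √(Δ₁² + ⋯ + Δ_n²), and Δ_min = min_i Δ_i. Let f : ℝⁿ → ℝ be twice continuously differentiable on an open set containing the hyperrectangle R(x⁰;d) = {x⁰ + x : 0 ≤ x_i ≤ Δ_i}, with ∇f Lipschitz continuous with constant L_{∇f} on R(x⁰;d). Let L_n ∈ ℝ^{n×n} have entries [L_n]_{i,i} = 12(3n−2)/(Δ_i²(3n+1)) and [L_n]_{i,j} = −36/(Δ_iΔ_j(3n+1)) for i ≠ j, and let T_n ∈ ℝⁿ have components [T_n]_i = ∫_{R(0;d)} x_i (f(x⁰+x) − f(x⁰)) dx over the box ∏_{i=1}^n [0, Δ_i]. Then ‖Δ⁻¹ · L_n · T_n − ∇f(x⁰)‖ ≤ (3/2) · √n · L_{∇f} · Δ_S² / Δ_min. -/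
open scoped BigOperators

noncomputable section

open MeasureTheory Set in
theorem setIntegral_box_prod_pow {n : ℕ} {Δ : Fin n → ℝ} (hΔ : ∀ i, 0 < Δ i) (a : Fin n → ℕ) :
    ∫ x in box Δ, ∏ i, x i ^ a i = (∏ i, Δ i) * ∏ i, Δ i ^ a i / (a i + 1) := by
  have hbox : box Δ = (@WithLp.ofLp 2 (Fin n → ℝ)) ⁻¹' univ.pi fun i => Icc 0 (Δ i) := by
    ext x; simp [box, Set.mem_pi, -Set.pi_univ_Icc]
  rw [hbox, (PiLp.volume_preserving_ofLp (Fin n)).setIntegral_preimage_emb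
    (MeasurableEquiv.toLp 2 (Fin n → ℝ)).symm.measurableEmbedding (fun y => ∏ i, y i ^ a i),
    volume_pi, Measure.restrict_pi_pi,
    integral_fintype_prod_eq_prod (f := fun i (t : ℝ) => t ^ a i), ← Finset.prod_mul_distrib]
  refine Finset.prod_congr rfl fun i _ => ?_
  rw [integral_Icc_eq_integral_Ioc, ← intervalIntegral.integral_of_le (hΔ i).le, integral_pow]
  simp [pow_succ]
  ring

theorem setIntegral_box_pow {n : ℕ} {Δ : Fin n → ℝ} (hΔ : ∀ i, 0 < Δ i) (j : Fin n) (p : ℕ) :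
    ∫ x in box Δ, x j ^ p = (∏ i, Δ i) * (Δ j ^ p / (p + 1)) := by
  have h := setIntegral_box_prod_pow hΔ fun i => if i = j then p else 0
  have h1 : ∀ x : EuclideanSpace ℝ (Fin n), ∏ i, x i ^ (if i = j then p else 0) = x j ^ p := by
    intro x; simp [pow_ite]
  have h2 : ∏ i, Δ i ^ (if i = j then p else 0) / (((if i = j then p else 0 : ℕ) : ℝ) + 1)
      = Δ j ^ p / (p + 1) := by
    rw [Finset.prod_eq_single j (by intro b _ hb; simp [hb]) (by simp)]
    simp
  simpa only [h1, h2] using h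

theorem setIntegral_box_pow_mul_pow {n : ℕ} {Δ : Fin n → ℝ} (hΔ : ∀ i, 0 < Δ i) {j k : Fin n}
    (hjk : j ≠ k) (p q : ℕ) :
    ∫ x in box Δ, x j ^ p * x k ^ q
      = (∏ i, Δ i) * (Δ j ^ p / (p + 1) * (Δ k ^ q / (q + 1))) := by
  have h := setIntegral_box_prod_pow hΔ fun i => if i = j then p else if i = k then q else 0
  have h1 : ∀ x : EuclideanSpace ℝ (Fin n),
      ∏ i, x i ^ (if i = j then p else if i = k then q else 0) = x j ^ p * x k ^ q := by
    intro x
    rw [Finset.prod_eq_mul j k hjk (by rintro c _ ⟨hc, hc'⟩; simp [hc, hc']) (by simp) (by simp)]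
    simp [hjk.symm]
  have h2 : ∏ i, Δ i ^ (if i = j then p else if i = k then q else 0) /
        (((if i = j then p else if i = k then q else 0 : ℕ) : ℝ) + 1)
      = Δ j ^ p / (p + 1) * (Δ k ^ q / (q + 1)) := by
    rw [Finset.prod_eq_mul j k hjk (by rintro c _ ⟨hc, hc'⟩; simp [hc, hc']) (by simp) (by simp)]
    simp [hjk.symm]
  simpa only [h1, h2] using h

theorem setIntegral_box_mul {n : ℕ} {Δ : Fin n → ℝ} (hΔ : ∀ i, 0 < Δ i) (j k : Fin n) :
    ∫ x in box Δ, x j * x k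
      = (∏ i, Δ i) * (Δ j * Δ k * ((if j = k then 1 / 12 else 0) + 1 / 4)) := by
  split_ifs with h
  · subst h
    have := setIntegral_box_pow hΔ j 2
    simp only [← sq, this]
    push_cast; ring
  · have := setIntegral_box_pow_mul_pow hΔ h 1 1
    simp only [pow_one] at this
    rw [this]
    push_cast; ring

theorem setIntegral_box_mul_sq_le {n : ℕ} {Δ : Fin n → ℝ} (hΔ : ∀ i, 0 < Δ i) (j k : Fin n) :
    ∫ x in box Δ, x j * x k ^ 2 ≤ (∏ i, Δ i) * (Δ j * Δ k ^ 2 / 4) := by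
  have hP : 0 < ∏ i, Δ i := Finset.prod_pos fun i _ => hΔ i
  by_cases h : j = k
  · subst h
    have := setIntegral_box_pow hΔ j 3
    simp only [← pow_succ', this]
    push_cast
    norm_num
  · have := setIntegral_box_pow_mul_pow hΔ h 1 2
    simp only [pow_one] at this
    rw [this]
    refine mul_le_mul_of_nonneg_left ?_ hP.le
    have : 0 < Δ j * Δ k ^ 2 := mul_pos (hΔ j) (pow_pos (hΔ k) 2)
    push_cast
    linarith

theorem isCompact_box {n : ℕ} (Δ : Fin n → ℝ) : IsCompact (box Δ) := by
  have hbox : box Δ = (EuclideanSpace.equiv (Fin n) ℝ).toHomeomorph ⁻¹'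
      Set.univ.pi fun i => Set.Icc 0 (Δ i) := by
    ext x; simp [box, Set.mem_pi, -Set.pi_univ_Icc]
  rw [hbox, Homeomorph.isCompact_preimage]
  exact isCompact_univ_pi fun i => isCompact_Icc

/-- Second-order Taylor estimate for a function with Lipschitz gradient on a set that contains the
segment from `a` to `a + x`. -/
theorem abs_sub_sub_inner_gradient_le {E : Type*} [NormedAddCommGroup E] [InnerProductSpace ℝ E]
    [CompleteSpace E] {f : E → ℝ} {s : Set E} {L : NNReal} {a x : E}
    (hseg : ∀ t ∈ Set.Icc (0 : ℝ) 1, a + t • x ∈ s) (hf : ∀ y ∈ s, DifferentiableAt ℝ f y)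
    (hlip : LipschitzOnWith L (gradient f) s) :
    |f (a + x) - f a - inner ℝ (gradient f a) x| ≤ L / 2 * ‖x‖ ^ 2 := by
  have ha : a ∈ s := by simpa using hseg 0 (by simp)
  have hder : ∀ t ∈ Set.Icc (0 : ℝ) 1,
      HasDerivAt (fun t : ℝ => f (a + t • x) - f a - t * inner ℝ (gradient f a) x)
        (inner ℝ (gradient f (a + t • x) - gradient f a) x) t := by
    intro t ht
    have h1 : HasDerivAt (fun t : ℝ => a + t • x) x t := by
      simpa using ((hasDerivAt_id t).smul_const x).const_add a
    have h2 := (hf _ (hseg t ht)).hasGradientAt.hasFDerivAt.comp_hasDerivAt t h1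
    rw [InnerProductSpace.toDual_apply_apply] at h2
    have h3 := (h2.sub_const (f a)).sub ((hasDerivAt_id t).mul_const (inner ℝ (gradient f a) x))
    rw [inner_sub_left]
    convert! h3 using 1
    simp
  have hB : ∀ t : ℝ, HasDerivAt (fun t : ℝ => L / 2 * ‖x‖ ^ 2 * t ^ 2) (L * ‖x‖ ^ 2 * t) t := by
    intro t
    have := (hasDerivAt_pow 2 t).const_mul ((L : ℝ) / 2 * ‖x‖ ^ 2)
    convert! this using 1
    push_cast; ring
  have key := image_norm_le_of_norm_deriv_right_le_deriv_boundary (a := (0 : ℝ)) (b := 1)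
    (fun t ht => (hder t ht).continuousAt.continuousWithinAt)
    (fun t ht => (hder t ⟨ht.1, ht.2.le⟩).hasDerivWithinAt) (by simp) hB
    (fun t ht => by
      have h1 := hlip.norm_sub_le (hseg t ⟨ht.1, ht.2.le⟩) ha
      rw [add_sub_cancel_left, norm_smul, Real.norm_of_nonneg ht.1] at h1
      calc _ ≤ ‖gradient f (a + t • x) - gradient f a‖ * ‖x‖ := norm_inner_le_norm _ _
        _ ≤ (L * (t * ‖x‖)) * ‖x‖ := by gcongr
        _ = _ := by ring)
    (Set.right_mem_Icc.2 zero_le_one)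
  simpa using key

theorem Lmat_apply {n : ℕ} {Δ : Fin n → ℝ} (hΔ : ∀ i, 0 < Δ i) (i j : Fin n) :
    Lmat n Δ i j = ((if i = j then 12 else 0) - 36 / (3 * n + 1)) / (Δ i * Δ j) := by
  have hi := (hΔ i).ne'
  have hj := (hΔ j).ne'
  have hn : (3 * (n : ℝ) + 1) ≠ 0 := by positivity
  simp only [Lmat, Matrix.of_apply]
  split_ifs with h
  · subst h; field_simp; ring
  · field_simp; ring

theorem Lmat_mulVec {n : ℕ} {Δ : Fin n → ℝ} (hΔ : ∀ i, 0 < Δ i) (v : Fin n → ℝ) (i : Fin n) :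
    (Lmat n Δ).mulVec v i
      = (12 * (v i / Δ i) - 36 / (3 * n + 1) * ∑ j, v j / Δ j) / Δ i := by
  have h : ∀ j, Lmat n Δ i j * v j = (if i = j then 12 * (v i / Δ i) / Δ i else 0)
      - 36 / (3 * n + 1) * (v j / Δ j) / Δ i := by
    intro j
    have hi := (hΔ i).ne'
    have hj := (hΔ j).ne'
    rw [Lmat_apply hΔ]
    split_ifs with h
    · subst h; field_simp
    · field_simp; ring
  simp only [Matrix.mulVec, dotProduct, h, Finset.sum_sub_distrib, Finset.sum_ite_eq,
    Finset.mem_univ, if_true, ← Finset.sum_div, ← Finset.mul_sum]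
  ring

/-- `Lmat` inverts the normalised second-moment matrix of the box. -/
theorem Lmat_mulVec_moments {n : ℕ} {Δ : Fin n → ℝ} (hΔ : ∀ i, 0 < Δ i) (g : Fin n → ℝ) :
    (Lmat n Δ).mulVec
      (fun j => ∑ k, g k * (Δ j * Δ k * ((if j = k then 1 / 12 else 0) + 1 / 4))) = g := by
  have h : ∀ j, (∑ k, g k * (Δ j * Δ k * ((if j = k then 1 / 12 else 0) + 1 / 4))) / Δ j
      = g j * Δ j / 12 + (∑ k, g k * Δ k) / 4 := by
    intro j
    have hj := (hΔ j).ne'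
    have h' : ∀ k, g k * (Δ j * Δ k * ((if j = k then 1 / 12 else 0) + 1 / 4)) / Δ j
        = (if j = k then g j * Δ j / 12 else 0) + g k * Δ k / 4 := by
      intro k
      split_ifs with h
      · subst h; field_simp
      · field_simp; ring
    simp only [Finset.sum_div, h', Finset.sum_add_distrib, Finset.sum_ite_eq, Finset.mem_univ,
      if_true]
  ext i
  have hi := (hΔ i).ne'
  have hn : (3 * (n : ℝ) + 1) ≠ 0 := by positivity
  rw [Lmat_mulVec hΔ]
  simp only [h, Finset.sum_add_distrib, ← Finset.sum_div, Finset.sum_const, Finset.card_univ,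
    Fintype.card_fin, nsmul_eq_mul]
  field_simp
  ring

theorem sum_sq_twelve_mul_sub_le {n : ℕ} (w : Fin n → ℝ) :
    ∑ i, (12 * w i - 36 / (3 * n + 1) * ∑ j, w j) ^ 2 ≤ 144 * ∑ i, w i ^ 2 := by
  set S := ∑ j, w j with hS
  set c : ℝ := 36 / (3 * n + 1) with hc
  have hpos : (0 : ℝ) < 3 * n + 1 := by positivity
  have hc0 : 0 ≤ c := by positivity
  have hnc : n * c ≤ 24 := by
    rw [hc, mul_div_assoc', div_le_iff₀ hpos]
    have : (0 : ℝ) ≤ n := by positivity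
    linarith
  have h : ∑ i, (12 * w i - c * S) ^ 2 = 144 * ∑ i, w i ^ 2 - c * S ^ 2 * (24 - n * c) := by
    have h' : ∀ i, (12 * w i - c * S) ^ 2 = 144 * w i ^ 2 - 24 * c * S * w i + c ^ 2 * S ^ 2 := by
      intro i; ring
    simp only [h', Finset.sum_add_distrib, Finset.sum_sub_distrib, ← Finset.mul_sum, ← hS,
      Finset.sum_const, Finset.card_univ, Fintype.card_fin, nsmul_eq_mul]
    ring
  rw [h]
  have : 0 ≤ c * S ^ 2 * (24 - n * c) := by
    have := sub_nonneg.2 hnc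
    positivity
  linarith

/-- A vector whose scaled entries are bounded by `B` is mapped by `Lmat` to one of norm at most
`12 √n B / Δ_min`. -/
theorem norm_vecE_Lmat_mulVec_le {n : ℕ} {Δ : Fin n → ℝ} (hΔ : ∀ i, 0 < Δ i) {m B : ℝ}
    (hm : 0 < m) (hmΔ : ∀ i, m ≤ Δ i) (hB : 0 ≤ B) {v : Fin n → ℝ} (hv : ∀ j, |v j / Δ j| ≤ B) :
    ‖vecE ((Lmat n Δ).mulVec v)‖ ≤ 12 * Real.sqrt n * B / m := by
  refine le_of_sq_le_sq ?_ (by positivity)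
  have hw : ∑ j, (v j / Δ j) ^ 2 ≤ n * B ^ 2 := by
    have := Finset.sum_le_sum fun j (_ : j ∈ Finset.univ) =>
      sq_le_sq' (abs_le.1 (hv j)).1 (abs_le.1 (hv j)).2
    simpa using this
  calc ‖vecE ((Lmat n Δ).mulVec v)‖ ^ 2 = ∑ i, (Lmat n Δ).mulVec v i ^ 2 := by
        rw [EuclideanSpace.real_norm_sq_eq]; rfl
    _ ≤ ∑ i, (12 * (v i / Δ i) - 36 / (3 * n + 1) * ∑ j, v j / Δ j) ^ 2 / m ^ 2 := by
        refine Finset.sum_le_sum fun i _ => ?_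
        rw [Lmat_mulVec hΔ, div_pow]
        have := hmΔ i
        gcongr
    _ ≤ 144 * (n * B ^ 2) / m ^ 2 := by
        rw [← Finset.sum_div]
        have := (sum_sq_twelve_mul_sub_le fun j => v j / Δ j).trans
          (mul_le_mul_of_nonneg_left hw (by norm_num))
        gcongr
    _ = (12 * Real.sqrt n * B / m) ^ 2 := by
        rw [div_pow, mul_pow, mul_pow, Real.sq_sqrt (Nat.cast_nonneg n)]; ring

open MeasureTheory in
/-- Theorem 4.5 of the paper (error bound ad infinitum, hyperrectangle):
`‖Δ⁻¹·Lₙ·Tₙ − ∇f(x⁰)‖ ≤ (3/2)·√n·L_{∇f}·Δ_S²/Δ_min`. -/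
theorem error_bound_ad_infinitum_hyperrectangle
    (n : ℕ) (hn : 1 ≤ n)
    (x0 : EuclideanSpace ℝ (Fin n))
    (Δ : Fin n → ℝ) (hΔ : ∀ i, 0 < Δ i)
    (f : EuclideanSpace ℝ (Fin n) → ℝ)
    (U : Set (EuclideanSpace ℝ (Fin n))) (hU : IsOpen U)
    (hsub : {y : EuclideanSpace ℝ (Fin n) | ∀ l, y l - x0 l ∈ Set.Icc (0 : ℝ) (Δ l)} ⊆ U)
    (hf : ContDiffOn ℝ 2 f U)
    (L : NNReal)
    (hlip : LipschitzOnWith L (gradient f)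
      {y : EuclideanSpace ℝ (Fin n) | ∀ l, y l - x0 l ∈ Set.Icc (0 : ℝ) (Δ l)}) :
    ‖vecE ((∏ l, Δ l)⁻¹ •
        Matrix.mulVec (Lmat n Δ)
          (fun j => ∫ x in box Δ, x j * (f (x0 + x) - f x0)))
      - gradient f x0‖
      ≤ (3 / 2) * Real.sqrt n * (L : ℝ)
          * Real.sqrt (∑ l, (Δ l) ^ 2) ^ 2 / (⨅ l, Δ l) := by
  have hP : 0 < ∏ l, Δ l := Finset.prod_pos fun i _ => hΔ i
  have hmem : ∀ x ∈ box Δ, ∀ t ∈ Set.Icc (0 : ℝ) 1,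
      x0 + t • x ∈ {y : EuclideanSpace ℝ (Fin n) | ∀ l, y l - x0 l ∈ Set.Icc (0 : ℝ) (Δ l)} := by
    intro x hx t ht l
    have hl := hx l
    simp only [PiLp.add_apply, PiLp.smul_apply, smul_eq_mul, add_sub_cancel_left]
    exact ⟨mul_nonneg ht.1 hl.1, (mul_le_of_le_one_left hl.1 ht.2).trans hl.2⟩
  have hdiff : ∀ y ∈ {y : EuclideanSpace ℝ (Fin n) | ∀ l, y l - x0 l ∈ Set.Icc (0 : ℝ) (Δ l)},
      DifferentiableAt ℝ f y := fun y hy =>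
    (hf.differentiableOn (by norm_num)).differentiableAt (hU.mem_nhds (hsub hy))
  have hrem : ∀ x ∈ box Δ,
      |f (x0 + x) - f x0 - inner ℝ (gradient f x0) x| ≤ L / 2 * ‖x‖ ^ 2 := fun x hx =>
    abs_sub_sub_inner_gradient_le (hmem x hx) hdiff hlip
  have hcont : ContinuousOn (fun x => f (x0 + x)) (box Δ) := by
    intro x hx
    have h1 : x0 + x ∈ U := hsub (by simpa using hmem x hx 1 (by simp))
    have h2 := (hf.continuousOn.continuousAt (hU.mem_nhds h1))
    exact (ContinuousAt.comp (f := fun x => x0 + x) h2 (by fun_prop)).continuousWithinAt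
  have hbox := isCompact_box Δ
  set g := gradient f x0 with hg
  set r : EuclideanSpace ℝ (Fin n) → ℝ := fun x => f (x0 + x) - f x0 - inner ℝ g x with hr
  have hrcont : ContinuousOn r (box Δ) :=
    (hcont.sub continuousOn_const).sub (by fun_prop)
  have hrint : ∀ j, IntegrableOn (fun x => x j * r x) (box Δ) := fun j =>
    ContinuousOn.integrableOn_compact hbox (by fun_prop)
  set R : Fin n → ℝ := fun j => (∏ l, Δ l)⁻¹ * ∫ x in box Δ, x j * r x with hR
  have hT : (∏ l, Δ l)⁻¹ • (fun j => ∫ x in box Δ, x j * (f (x0 + x) - f x0))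
      = (fun j => ∑ k, g k * (Δ j * Δ k * ((if j = k then 1 / 12 else 0) + 1 / 4))) + R := by
    ext j
    have h1 : ∀ x : EuclideanSpace ℝ (Fin n),
        x j * (f (x0 + x) - f x0) = (∑ k, g k * (x j * x k)) + x j * r x := by
      intro x
      have : inner ℝ g x = ∑ k, g k * x k := by
        simp [PiLp.inner_apply, mul_comm]
      simp only [hr, this, mul_left_comm (g _) (x j), ← Finset.mul_sum]
      ring
    have h2 : ∀ k, IntegrableOn (fun x : EuclideanSpace ℝ (Fin n) => g k * (x j * x k)) (box Δ) :=
      fun k => ContinuousOn.integrableOn_compact hbox (by fun_prop)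
    simp only [Pi.smul_apply, Pi.add_apply, smul_eq_mul, h1]
    rw [integral_add (integrable_finsetSum _ fun k _ => h2 k) (hrint j),
      integral_finsetSum _ fun k _ => h2 k, mul_add]
    simp only [integral_const_mul, setIntegral_box_mul hΔ, hR]
    rw [Finset.mul_sum]
    congr 1
    refine Finset.sum_congr rfl fun k _ => ?_
    field_simp
  have hRle : ∀ j, |R j / Δ j| ≤ L * (∑ l, Δ l ^ 2) / 8 := by
    intro j
    have hint : ∀ k, IntegrableOn (fun x : EuclideanSpace ℝ (Fin n) => x j * x k ^ 2) (box Δ) :=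
      fun k => ContinuousOn.integrableOn_compact hbox (by fun_prop)
    have h1 : |∫ x in box Δ, x j * r x| ≤ ∫ x in box Δ, L / 2 * ∑ k, x j * x k ^ 2 := by
      rw [← Real.norm_eq_abs]
      refine norm_integral_le_of_norm_le
        ((integrable_finsetSum _ fun k _ => hint k).const_mul _) ?_
      refine (ae_restrict_iff' hbox.measurableSet).2 (ae_of_all _ fun x hx => ?_)
      have := mul_le_mul_of_nonneg_left (hrem x hx) (hx j).1
      rw [EuclideanSpace.real_norm_sq_eq] at this
      rw [norm_mul, Real.norm_of_nonneg (hx j).1, ← Finset.mul_sum, mul_left_comm]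
      exact this
    have h2 : ∫ x in box Δ, L / 2 * ∑ k, x j * x k ^ 2
        ≤ (∏ l, Δ l) * (Δ j * (L * (∑ l, Δ l ^ 2) / 8)) := by
      rw [integral_const_mul, integral_finsetSum _ fun k _ => hint k]
      calc _ ≤ (L : ℝ) / 2 * ∑ k, (∏ i, Δ i) * (Δ j * Δ k ^ 2 / 4) := by
            gcongr with k; exact setIntegral_box_mul_sq_le hΔ j k
        _ = _ := by
            simp only [← Finset.mul_sum, ← Finset.sum_div]; ring
    rw [abs_div, abs_of_pos (hΔ j), div_le_iff₀ (hΔ j), hR]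
    simp only [abs_mul, abs_inv, abs_of_pos hP]
    rw [inv_mul_le_iff₀ hP]
    exact (h1.trans h2).trans_eq (by ring)
  have : Nonempty (Fin n) := ⟨⟨0, hn⟩⟩
  obtain ⟨i0, hi0⟩ := exists_eq_ciInf_of_finite (f := Δ)
  have hm : 0 < ⨅ l, Δ l := hi0 ▸ hΔ i0
  have hfinal := norm_vecE_Lmat_mulVec_le hΔ hm (fun i => ciInf_le (Set.finite_range Δ).bddBelow i)
    (by positivity) hRle
  have heq : vecE ((∏ l, Δ l)⁻¹ • Matrix.mulVec (Lmat n Δ)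
      (fun j => ∫ x in box Δ, x j * (f (x0 + x) - f x0))) - g = vecE ((Lmat n Δ).mulVec R) := by
    rw [← Matrix.mulVec_smul, hT, Matrix.mulVec_add, Lmat_mulVec_moments hΔ]
    ext i
    simp [vecE]
  rw [heq, Real.sq_sqrt (Finset.sum_nonneg fun l _ => sq_nonneg _)]
  refine hfinal.trans_eq ?_
  ring

end
end

section
/- Fix n ≥ 1, r > 0, and x⁰ ∈ ℝⁿ. Let f : ℝⁿ → ℝ be three times continuously differentiable on an open set containing the closed ball B_n(x⁰;r), with ∇²f Lipschitz continuous with constant L_H on B_n(x⁰;r). Define T_n ∈ ℝⁿ by [T_n]_i = ∫_{B_n(0;r)} x_i · (f(x⁰+x) − f(x⁰)) dx, let V_{n+2} = 2π^{n/2+1} r^{n+2} / (Γ(n/2+1)(n+2)), and let η = Γ((n+4)/2) / (√π · Γ((n+3)/2)). Then ‖(2π / V_{n+2}) · T_n − ∇f(x⁰)‖ ≤ (√n / (3√π)) · L_H · η · r². -/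
open scoped BigOperators

noncomputable section

/-- The volume of the ball of radius `r` in `ℝ^{n+2}`:
`V_{n+2} = 2π^{n/2+1} r^{n+2} / (Γ(n/2+1)(n+2))`. -/
def Vnp2 (n : ℕ) (r : ℝ) : ℝ :=
  2 * Real.pi ^ ((n : ℝ) / 2 + 1) * r ^ (n + 2)
    / (Real.Gamma ((n : ℝ) / 2 + 1) * ((n : ℝ) + 2))

section Auxiliary

open MeasureTheory Metric
open scoped RealInnerProductSpace

theorem gamma_ratio_lower (n : ℕ) :
    ((n : ℝ) + 2) / (2 * (n + 4)) ≤
      Real.Gamma (((n : ℝ) + 4) / 2) / (Real.pi * Real.Gamma (((n : ℝ) + 3) / 2)) := by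
  have hn : (0 : ℝ) ≤ n := n.cast_nonneg
  have h2 : 0 < ((n : ℝ) + 2) / 2 := by positivity
  have hG2 := Real.Gamma_pos_of_pos h2
  have hG3 : 0 < Real.Gamma (((n : ℝ) + 3) / 2) := Real.Gamma_pos_of_pos (by positivity)
  have hG4 : Real.Gamma (((n : ℝ) + 4) / 2) =
      ((n : ℝ) + 2) / 2 * Real.Gamma (((n : ℝ) + 2) / 2) := by
    rw [← Real.Gamma_add_one h2.ne']; congr 1; ring
  have hlog := Real.Gamma_mul_add_mul_le_rpow_Gamma_mul_rpow_Gamma h2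
    (t := ((n : ℝ) + 4) / 2) (by positivity) one_half_pos one_half_pos (by norm_num)
  rw [show (1 / 2 : ℝ) * (((n : ℝ) + 2) / 2) + 1 / 2 * (((n : ℝ) + 4) / 2) = ((n : ℝ) + 3) / 2 by
    ring, ← Real.sqrt_eq_rpow, ← Real.sqrt_eq_rpow] at hlog
  have hsq : Real.Gamma (((n : ℝ) + 3) / 2) ^ 2 ≤
      ((n : ℝ) + 2) / 2 * Real.Gamma (((n : ℝ) + 2) / 2) ^ 2 := by
    have := pow_le_pow_left₀ hG3.le hlog 2
    rw [mul_pow, Real.sq_sqrt hG2.le, Real.sq_sqrt (hG4 ▸ by positivity), hG4] at this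
    linarith
  have hpi : Real.pi ^ 2 ≤ 10 := by nlinarith [Real.pi_lt_d2, Real.pi_pos]
  rw [div_le_div_iff₀ (by positivity) (by positivity), hG4]
  have key : Real.pi * Real.Gamma (((n : ℝ) + 3) / 2) ≤
      (n + 4) * Real.Gamma (((n : ℝ) + 2) / 2) := by
    rw [← pow_le_pow_iff_left₀ (by positivity) (by positivity) two_ne_zero, mul_pow, mul_pow]
    calc Real.pi ^ 2 * Real.Gamma (((n : ℝ) + 3) / 2) ^ 2
        ≤ 10 * (((n : ℝ) + 2) / 2 * Real.Gamma (((n : ℝ) + 2) / 2) ^ 2) := by gcongr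
      _ = 5 * (n + 2) * Real.Gamma (((n : ℝ) + 2) / 2) ^ 2 := by ring
      _ ≤ _ := by
        gcongr
        nlinarith
  nlinarith

theorem continuousOn_sub_center {E : Type*} [NormedAddCommGroup E] {f : E → ℝ} {U : Set E}
    (hf : ContinuousOn f U) {x₀ : E} {r : ℝ} (hsub : closedBall x₀ r ⊆ U) :
    ContinuousOn (fun x => f (x₀ + x) - f x₀) (closedBall 0 r) :=
  (hf.comp (by fun_prop) fun x hx => hsub (by simpa using hx)).sub continuousOn_const

section Ball

variable {E : Type*} [NormedAddCommGroup E] [InnerProductSpace ℝ E] [FiniteDimensional ℝ E]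
  [MeasurableSpace E] [BorelSpace E]

theorem setIntegral_closedBall_norm_pow [Nontrivial E] {r : ℝ} (hr : 0 < r) (k : ℕ) :
    ∫ x in closedBall (0 : E) r, ‖x‖ ^ k =
      Module.finrank ℝ E * volume.real (ball (0 : E) 1) * r ^ (Module.finrank ℝ E + k) /
        (Module.finrank ℝ E + k) := by
  have hd : 0 < Module.finrank ℝ E := Module.finrank_pos
  have h := integral_fun_norm_addHaar (volume : Measure E)
    ((Set.Iic r).indicator fun y : ℝ => y ^ k)
  have h1 : (fun x : E => (Set.Iic r).indicator (fun y : ℝ => y ^ k) ‖x‖) =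
      (closedBall (0 : E) r).indicator fun x => ‖x‖ ^ k := by
    ext x
    by_cases hx : ‖x‖ ≤ r <;> simp [hx]
  have h2 : (fun y : ℝ => y ^ (Module.finrank ℝ E - 1) •
      (Set.Iic r).indicator (fun y : ℝ => y ^ k) y) =
      (Set.Iic r).indicator fun y => y ^ (Module.finrank ℝ E - 1 + k) := by
    ext y
    simp [Set.indicator_apply, pow_add]
  rw [h1, integral_indicator measurableSet_closedBall, h2,
    setIntegral_indicator measurableSet_Iic, Set.Ioi_inter_Iic,
    ← intervalIntegral.integral_of_le hr.le, integral_pow] at h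
  rw [h, show Module.finrank ℝ E - 1 + k + 1 = Module.finrank ℝ E + k by omega]
  have : ((Module.finrank ℝ E - 1 + k : ℕ) : ℝ) + 1 = Module.finrank ℝ E + k := by
    rw [← Nat.cast_add_one, show Module.finrank ℝ E - 1 + k + 1 = Module.finrank ℝ E + k by omega,
      Nat.cast_add]
  rw [this, zero_pow (by omega)]
  simp only [nsmul_eq_mul, smul_eq_mul, sub_zero]
  ring

theorem setIntegral_closedBall_comp_isometry (A : E ≃ₗᵢ[ℝ] E) (r : ℝ) (g : E → ℝ) :
    ∫ x in closedBall (0 : E) r, g (A x) = ∫ x in closedBall (0 : E) r, g x := by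
  have h := A.measurePreserving.setIntegral_preimage_emb
    A.toHomeomorph.measurableEmbedding g (closedBall 0 r)
  rwa [A.preimage_closedBall, map_zero] at h

theorem setIntegral_closedBall_inner_sq_congr {u v : E} (huv : ‖u‖ = ‖v‖) (r : ℝ) (k : ℕ) :
    ∫ x in closedBall (0 : E) r, ⟪x, u⟫ ^ 2 * ‖x‖ ^ k =
      ∫ x in closedBall (0 : E) r, ⟪x, v⟫ ^ 2 * ‖x‖ ^ k := by
  obtain ⟨A, rfl⟩ : ∃ A : E ≃ₗᵢ[ℝ] E, A u = v := ⟨_, Submodule.reflection_sub huv⟩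
  rw [← setIntegral_closedBall_comp_isometry A r fun x => ⟪x, A u⟫ ^ 2 * ‖x‖ ^ k]
  simp

theorem Continuous.integrableOn_closedBall {g : E → ℝ} (hg : Continuous g) (r : ℝ) :
    IntegrableOn g (closedBall 0 r) :=
  hg.continuousOn.integrableOn_compact (isCompact_closedBall 0 r)

theorem setIntegral_closedBall_inner_sq [Nontrivial E] (u : E) {r : ℝ} (hr : 0 < r) (k : ℕ) :
    ∫ x in closedBall (0 : E) r, ⟪x, u⟫ ^ 2 * ‖x‖ ^ k =
      ‖u‖ ^ 2 * (volume.real (ball (0 : E) 1) * r ^ (Module.finrank ℝ E + k + 2) /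
        (Module.finrank ℝ E + k + 2)) := by
  have hd : (0 : ℝ) < Module.finrank ℝ E := by exact_mod_cast Module.finrank_pos
  let b := stdOrthonormalBasis ℝ E
  have hsum : ∑ i, ∫ x in closedBall (0 : E) r, ⟪x, ‖u‖ • b i⟫ ^ 2 * ‖x‖ ^ k =
      ‖u‖ ^ 2 * ∫ x in closedBall (0 : E) r, ‖x‖ ^ (k + 2) := by
    rw [← integral_finsetSum _ fun i _ =>
      Continuous.integrableOn_closedBall (by fun_prop) r, ← integral_const_mul]
    congr 1 with x
    rw [← Finset.sum_mul, pow_add ‖x‖, ← b.sum_sq_inner_left x]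
    simp only [inner_smul_right, mul_pow, ← Finset.mul_sum]
    ring
  have hcongr : ∀ i, ∫ x in closedBall (0 : E) r, ⟪x, ‖u‖ • b i⟫ ^ 2 * ‖x‖ ^ k =
      ∫ x in closedBall (0 : E) r, ⟪x, u⟫ ^ 2 * ‖x‖ ^ k := fun i =>
    setIntegral_closedBall_inner_sq_congr (by simp [norm_smul]) r k
  simp only [hcongr, Finset.sum_const, Finset.card_univ, Fintype.card_fin, nsmul_eq_mul,
    setIntegral_closedBall_norm_pow hr] at hsum
  rw [← mul_right_inj' hd.ne', hsum]
  push_cast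
  ring

theorem setIntegral_closedBall_inner_mul_inner [Nontrivial E] (u v : E) {r : ℝ} (hr : 0 < r) :
    ∫ x in closedBall (0 : E) r, ⟪x, u⟫ * ⟪x, v⟫ =
      ⟪u, v⟫ * (volume.real (ball (0 : E) 1) * r ^ (Module.finrank ℝ E + 2) /
        (Module.finrank ℝ E + 2)) := by
  have hp := setIntegral_closedBall_inner_sq (u + v) hr 0
  have hm := setIntegral_closedBall_inner_sq (u - v) hr 0
  have h : ∫ x in closedBall (0 : E) r, ⟪x, u⟫ * ⟪x, v⟫ =
      ((∫ x in closedBall (0 : E) r, ⟪x, u + v⟫ ^ 2 * ‖x‖ ^ 0) -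
        ∫ x in closedBall (0 : E) r, ⟪x, u - v⟫ ^ 2 * ‖x‖ ^ 0) / 4 := by
    rw [← integral_sub (Continuous.integrableOn_closedBall (by fun_prop) r)
      (Continuous.integrableOn_closedBall (by fun_prop) r), ← integral_div]
    congr 1 with x
    rw [inner_add_right, inner_sub_right]
    ring
  rw [h, hp, hm, norm_add_sq_real, norm_sub_sq_real]
  push_cast
  ring

theorem setIntegral_closedBall_of_odd {g : E → ℝ} (hg : ∀ x, g (-x) = -g x) (r : ℝ) :
    ∫ x in closedBall (0 : E) r, g x = 0 := by
  have h := setIntegral_closedBall_comp_isometry (LinearIsometryEquiv.neg ℝ) r g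
  simp only [LinearIsometryEquiv.coe_neg, hg, integral_neg] at h
  linarith

theorem setIntegral_closedBall_abs_inner_mul_norm_cube_le [Nontrivial E] {u : E} (hu : ‖u‖ = 1)
    {r : ℝ} (hr : 0 < r) :
    ∫ x in closedBall (0 : E) r, |⟪x, u⟫| * ‖x‖ ^ 3 ≤
      √(Module.finrank ℝ E) * (volume.real (ball (0 : E) 1) * r ^ (Module.finrank ℝ E + 4) /
        (Module.finrank ℝ E + 4)) := by
  have hd : (0 : ℝ) < Module.finrank ℝ E := by exact_mod_cast Module.finrank_pos
  set s := √(Module.finrank ℝ E : ℝ)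
  have hs : 0 < s := Real.sqrt_pos.2 hd
  have hss : s ^ 2 = Module.finrank ℝ E := Real.sq_sqrt hd.le
  calc ∫ x in closedBall (0 : E) r, |⟪x, u⟫| * ‖x‖ ^ 3
      ≤ ∫ x in closedBall (0 : E) r, (s / 2 * (⟪x, u⟫ ^ 2 * ‖x‖ ^ 2) + 1 / (2 * s) * ‖x‖ ^ 4) := by
        refine setIntegral_mono (Continuous.integrableOn_closedBall (by fun_prop) r)
          (Continuous.integrableOn_closedBall (by fun_prop) r) fun x => ?_
        have h : s / 2 * (⟪x, u⟫ ^ 2 * ‖x‖ ^ 2) + 1 / (2 * s) * ‖x‖ ^ 4 - |⟪x, u⟫| * ‖x‖ ^ 3 =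
            1 / (2 * s) * (s * |⟪x, u⟫| * ‖x‖ - ‖x‖ ^ 2) ^ 2 := by
          rw [← sq_abs ⟪x, u⟫]
          field_simp
          ring
        have : 0 ≤ 1 / (2 * s) * (s * |⟪x, u⟫| * ‖x‖ - ‖x‖ ^ 2) ^ 2 := by positivity
        linarith
    _ = _ := by
        rw [integral_add (Continuous.integrableOn_closedBall (by fun_prop) r)
          (Continuous.integrableOn_closedBall (by fun_prop) r), integral_const_mul,
          integral_const_mul, setIntegral_closedBall_inner_sq u hr,
          setIntegral_closedBall_norm_pow hr, hu, ← hss]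
        push_cast
        field_simp
        ring

end Ball

section Taylor

variable {E : Type*} [NormedAddCommGroup E] [InnerProductSpace ℝ E] [CompleteSpace E]

theorem ContDiffOn.differentiableAt_gradient {f : E → ℝ} {U : Set E} (hU : IsOpen U)
    (hf : ContDiffOn ℝ 2 f U) {x : E} (hx : x ∈ U) : DifferentiableAt ℝ (gradient f) x := by
  let T : (E →L[ℝ] ℝ) →L[ℝ] E :=
    { toFun := (InnerProductSpace.toDual ℝ E).symm
      map_add' := map_add _
      map_smul' := fun c y => by simp
      cont := (InnerProductSpace.toDual ℝ E).symm.continuous }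
  have h1 : ContDiffOn ℝ 1 (fderiv ℝ f) U := hf.fderiv_of_isOpen hU (by norm_num)
  have h : DifferentiableAt ℝ (fderiv ℝ f) x :=
    (h1.differentiableOn (by norm_num)).differentiableAt (hU.mem_nhds hx)
  exact T.differentiableAt.comp x h

theorem abs_taylor_remainder_le {f : E → ℝ} {U : Set E} (hU : IsOpen U)
    (hf : ContDiffOn ℝ 2 f U) {x₀ : E} {r : ℝ} (hr : 0 ≤ r) (hsub : closedBall x₀ r ⊆ U)
    {L : NNReal} (hlip : LipschitzOnWith L (fderiv ℝ (gradient f)) (closedBall x₀ r))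
    {x : E} (hx : ‖x‖ ≤ r) :
    |f (x₀ + x) - f x₀ - ⟪gradient f x₀, x⟫ - ⟪fderiv ℝ (gradient f) x₀ x, x⟫ / 2| ≤
      L / 6 * ‖x‖ ^ 3 := by
  have hball : ∀ t ∈ Set.Icc (0 : ℝ) 1, x₀ + t • x ∈ closedBall x₀ r := fun t ht => by
    rw [mem_closedBall, dist_self_add_left, norm_smul, Real.norm_of_nonneg ht.1]
    nlinarith [ht.2, norm_nonneg x]
  have hline : ∀ t : ℝ, HasDerivAt (fun t : ℝ => x₀ + t • x) x t := fun t => by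
    simpa using ((hasDerivAt_id t).smul_const x).const_add x₀
  have hdf : ∀ t ∈ Set.Icc (0 : ℝ) 1,
      HasDerivAt (fun t : ℝ => f (x₀ + t • x)) ⟪gradient f (x₀ + t • x), x⟫ t := fun t ht => by
    have h : DifferentiableAt ℝ f (x₀ + t • x) :=
      (hf.differentiableOn (by norm_num)).differentiableAt (hU.mem_nhds (hsub (hball t ht)))
    simpa [Function.comp_def] using h.hasGradientAt.hasFDerivAt.comp_hasDerivAt t (hline t)
  have hdg : ∀ t ∈ Set.Icc (0 : ℝ) 1,
      HasDerivAt (fun t : ℝ => ⟪gradient f (x₀ + t • x), x⟫)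
        ⟪fderiv ℝ (gradient f) (x₀ + t • x) x, x⟫ t := fun t ht => by
    have h := (hf.differentiableAt_gradient hU (hsub (hball t ht))).hasFDerivAt.comp_hasDerivAt t
      (hline t)
    simpa using h.inner ℝ (hasDerivAt_const t x)
  have hB : ∀ t ∈ Set.Icc (0 : ℝ) 1, ‖⟪fderiv ℝ (gradient f) (x₀ + t • x) x, x⟫ -
      ⟪fderiv ℝ (gradient f) x₀ x, x⟫‖ ≤ L * ‖x‖ ^ 3 * t := fun t ht => by
    have h := hlip.norm_sub_le (hball t ht) (mem_closedBall_self hr)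
    rw [add_sub_cancel_left, norm_smul, Real.norm_of_nonneg ht.1] at h
    rw [← inner_sub_left, ← sub_apply]
    calc _ ≤ ‖(fderiv ℝ (gradient f) (x₀ + t • x) - fderiv ℝ (gradient f) x₀) x‖ * ‖x‖ :=
          norm_inner_le_norm _ _
      _ ≤ L * (t * ‖x‖) * ‖x‖ * ‖x‖ := by
        gcongr
        exact ContinuousLinearMap.le_of_opNorm_le _ h x
      _ = _ := by ring
  have hfirst : ∀ t ∈ Set.Icc (0 : ℝ) 1, ‖⟪gradient f (x₀ + t • x), x⟫ - ⟪gradient f x₀, x⟫ -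
      t * ⟪fderiv ℝ (gradient f) x₀ x, x⟫‖ ≤ L * ‖x‖ ^ 3 * (t ^ 2 / 2) := by
    have hd : ∀ t ∈ Set.Icc (0 : ℝ) 1, HasDerivAt (fun t : ℝ => ⟪gradient f (x₀ + t • x), x⟫ -
        ⟪gradient f x₀, x⟫ - t * ⟪fderiv ℝ (gradient f) x₀ x, x⟫)
        (⟪fderiv ℝ (gradient f) (x₀ + t • x) x, x⟫ - ⟪fderiv ℝ (gradient f) x₀ x, x⟫) t :=
      fun t ht => by
        simpa using ((hdg t ht).sub_const _).fun_sub ((hasDerivAt_id t).mul_const _)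
    refine image_norm_le_of_norm_deriv_right_le_deriv_boundary
      (fun t ht => (hd t ht).continuousAt.continuousWithinAt)
      (fun t ht => (hd t (Set.Ico_subset_Icc_self ht)).hasDerivWithinAt) (by simp)
      (fun t => ?_) (fun t ht => hB t (Set.Ico_subset_Icc_self ht))
    simpa using ((hasDerivAt_pow 2 t).div_const 2).const_mul ((L : ℝ) * ‖x‖ ^ 3)
  have hd : ∀ t ∈ Set.Icc (0 : ℝ) 1, HasDerivAt (fun t : ℝ => f (x₀ + t • x) - f x₀ -
      t * ⟪gradient f x₀, x⟫ - t ^ 2 / 2 * ⟪fderiv ℝ (gradient f) x₀ x, x⟫)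
      (⟪gradient f (x₀ + t • x), x⟫ - ⟪gradient f x₀, x⟫ -
        t * ⟪fderiv ℝ (gradient f) x₀ x, x⟫) t := fun t ht => by
    simpa using (((hdf t ht).sub_const (f x₀)).fun_sub ((hasDerivAt_id t).mul_const _)).fun_sub
      (((hasDerivAt_pow 2 t).div_const 2).mul_const _)
  have hsecond := image_norm_le_of_norm_deriv_right_le_deriv_boundary
    (B := fun t => L * ‖x‖ ^ 3 * (t ^ 3 / 6))
    (fun t ht => (hd t ht).continuousAt.continuousWithinAt)
    (fun t ht => (hd t (Set.Ico_subset_Icc_self ht)).hasDerivWithinAt) (by simp)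
    (fun t => by
      convert! ((hasDerivAt_pow 3 t).div_const 6).const_mul ((L : ℝ) * ‖x‖ ^ 3) using 1
      simp only [Nat.cast_ofNat]
      ring) (fun t ht => hfirst t (Set.Ico_subset_Icc_self ht)) (Set.right_mem_Icc.2 zero_le_one)
  simp only [one_smul, one_mul, one_pow, Real.norm_eq_abs] at hsecond
  convert hsecond using 1
  · congr 1
    ring
  · ring

end Taylor

section GradientEstimate

variable {E : Type*} [NormedAddCommGroup E] [InnerProductSpace ℝ E] [FiniteDimensional ℝ E]
  [MeasurableSpace E] [BorelSpace E] [Nontrivial E]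

theorem abs_setIntegral_inner_mul_sub_le {f : E → ℝ} {U : Set E} (hU : IsOpen U)
    (hf : ContDiffOn ℝ 2 f U) {x₀ : E} {r : ℝ} (hr : 0 < r) (hsub : closedBall x₀ r ⊆ U)
    {L : NNReal} (hlip : LipschitzOnWith L (fderiv ℝ (gradient f)) (closedBall x₀ r))
    {u : E} (hu : ‖u‖ = 1) :
    |(∫ x in closedBall (0 : E) r, ⟪x, u⟫ * (f (x₀ + x) - f x₀)) -
        ⟪gradient f x₀, u⟫ * (volume.real (ball (0 : E) 1) * r ^ (Module.finrank ℝ E + 2) /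
          (Module.finrank ℝ E + 2))| ≤
      L / 6 * (√(Module.finrank ℝ E) * (volume.real (ball (0 : E) 1) *
        r ^ (Module.finrank ℝ E + 4) / (Module.finrank ℝ E + 4))) := by
  have hfc := continuousOn_sub_center hf.continuousOn hsub
  have hodd : ∫ x in closedBall (0 : E) r, ⟪x, u⟫ * (⟪fderiv ℝ (gradient f) x₀ x, x⟫ / 2) = 0 :=
    setIntegral_closedBall_of_odd (fun x => by simp) r
  have integrableOn : ∀ {g : E → ℝ}, ContinuousOn g (closedBall 0 r) →
      IntegrableOn g (closedBall 0 r) :=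
    fun hg => hg.integrableOn_compact (isCompact_closedBall 0 r)
  have hi : ContinuousOn (fun x : E => ⟪x, u⟫) (closedBall 0 r) := by fun_prop
  have hfi := hi.fun_mul hfc
  have hgi : ContinuousOn (fun x => ⟪x, u⟫ * ⟪x, gradient f x₀⟫) (closedBall 0 r) := by fun_prop
  have hbi : ContinuousOn (fun x : E => (L : ℝ) / 6 * (|⟪x, u⟫| * ‖x‖ ^ 3))
      (closedBall 0 r) := by fun_prop
  have hqi : ContinuousOn (fun x => ⟪x, u⟫ * (⟪fderiv ℝ (gradient f) x₀ x, x⟫ / 2))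
      (closedBall 0 r) := by fun_prop
  rw [real_inner_comm, ← setIntegral_closedBall_inner_mul_inner u _ hr,
    ← sub_zero (_ - _), ← hodd, ← integral_sub (integrableOn hfi) (integrableOn hgi),
    ← integral_sub (integrableOn (hfi.fun_sub hgi)) (integrableOn hqi),
    ← Real.norm_eq_abs]
  calc _ ≤ ∫ x in closedBall (0 : E) r, L / 6 * (|⟪x, u⟫| * ‖x‖ ^ 3) := by
        refine norm_integral_le_of_norm_le (integrableOn hbi)
          ((ae_restrict_iff' measurableSet_closedBall).2 (.of_forall fun x hx => ?_))
        have h := abs_taylor_remainder_le hU hf hr.le hsub hlip (mem_closedBall_zero_iff.1 hx)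
        rw [← mul_sub, real_inner_comm (gradient f x₀), ← mul_sub, Real.norm_eq_abs, abs_mul,
          mul_left_comm]
        gcongr
    _ ≤ _ := by
        rw [integral_const_mul]
        gcongr
        exact setIntegral_closedBall_abs_inner_mul_norm_cube_le hu hr

theorem norm_smul_setIntegral_sub_gradient_le {f : E → ℝ} {U : Set E} (hU : IsOpen U)
    (hf : ContDiffOn ℝ 2 f U) {x₀ : E} {r : ℝ} (hr : 0 < r) (hsub : closedBall x₀ r ⊆ U)
    {L : NNReal} (hlip : LipschitzOnWith L (fderiv ℝ (gradient f)) (closedBall x₀ r)) :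
    ‖((Module.finrank ℝ E + 2) / (volume.real (ball (0 : E) 1) * r ^ (Module.finrank ℝ E + 2))) •
        (∫ x in closedBall (0 : E) r, (f (x₀ + x) - f x₀) • x) - gradient f x₀‖ ≤
      √(Module.finrank ℝ E) / 3 * L *
        ((Module.finrank ℝ E + 2) / (2 * (Module.finrank ℝ E + 4))) * r ^ 2 := by
  have hV : 0 < volume.real (ball (0 : E) 1) :=
    ENNReal.toReal_pos (measure_ball_pos volume 0 one_pos).ne' measure_ball_lt_top.ne
  set V := volume.real (ball (0 : E) 1)
  set d := Module.finrank ℝ E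
  set I := ∫ x in closedBall (0 : E) r, (f (x₀ + x) - f x₀) • x
  set c := ((d : ℝ) + 2) / (V * r ^ (d + 2))
  have hc : 0 < c := by positivity
  set w := c • I - gradient f x₀
  rcases eq_or_ne w 0 with hw | hw
  · rw [hw, norm_zero]
    positivity
  have hfc := continuousOn_sub_center hf.continuousOn hsub
  set u := ‖w‖⁻¹ • w
  have hu : ‖u‖ = 1 := norm_smul_inv_norm hw
  have hwu : ⟪w, u⟫ = ‖w‖ := by
    rw [inner_smul_right, real_inner_self_eq_norm_sq]
    field_simp [norm_ne_zero_iff.2 hw]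
  have hI : ⟪I, u⟫ = ∫ x in closedBall (0 : E) r, ⟪x, u⟫ * (f (x₀ + x) - f x₀) := by
    rw [real_inner_comm, ← integral_inner (f := fun x => (f (x₀ + x) - f x₀) • x)
      (ContinuousOn.integrableOn_compact (isCompact_closedBall 0 r)
        (hfc.fun_smul continuousOn_id))]
    congr 1 with x
    rw [inner_smul_right, real_inner_comm, mul_comm]
  have h := abs_setIntegral_inner_mul_sub_le hU hf hr hsub hlip hu
  rw [← hI] at h
  have hw' : ‖w‖ = c * (⟪I, u⟫ - ⟪gradient f x₀, u⟫ * (V * r ^ (d + 2) / (d + 2))) := by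
    rw [← hwu, inner_sub_left, inner_smul_left]
    simp only [c, conj_trivial]
    field_simp
  calc ‖w‖ ≤ c * (L / 6 * (√d * (V * r ^ (d + 4) / (d + 4)))) := by
        rw [hw']
        gcongr
        exact (le_abs_self _).trans h
    _ = _ := by
        simp only [c]
        field_simp
        ring

end GradientEstimate

theorem two_pi_div_Vnp2 {n : ℕ} (hn : 1 ≤ n) {r : ℝ} (hr : 0 < r) :
    2 * Real.pi / Vnp2 n r = ((n : ℝ) + 2) /
      (volume.real (ball (0 : EuclideanSpace ℝ (Fin n)) 1) * r ^ (n + 2)) := by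
  have : Nonempty (Fin n) := ⟨⟨0, hn⟩⟩
  have hG : 0 < Real.Gamma ((n : ℝ) / 2 + 1) := Real.Gamma_pos_of_pos (by positivity)
  have hsqrt : Real.pi ^ ((n : ℝ) / 2) = √Real.pi ^ n := by
    rw [Real.sqrt_eq_rpow, ← Real.rpow_mul_natCast Real.pi_pos.le]
    congr 1
    ring
  rw [Vnp2, Measure.real, EuclideanSpace.volume_ball, Real.rpow_add_one Real.pi_ne_zero, hsqrt,
    Fintype.card_fin, ENNReal.ofReal_one, one_pow, one_mul, ENNReal.toReal_ofReal (by positivity)]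
  field_simp

theorem vecE_mul_setIntegral {n : ℕ} (c : ℝ) {s : Set (EuclideanSpace ℝ (Fin n))}
    {g : EuclideanSpace ℝ (Fin n) → ℝ} (hg : IntegrableOn (fun x => g x • x) s) :
    vecE (fun i => c * ∫ x in s, x i * g x) = c • ∫ x in s, g x • x := by
  ext i
  have h := (EuclideanSpace.proj (𝕜 := ℝ) i).integral_comp_comm hg
  calc c * ∫ x in s, x i * g x = c * ∫ x in s, EuclideanSpace.proj (𝕜 := ℝ) i (g x • x) := by
        simp [mul_comm]
    _ = _ := by rw [h]; rfl

end Auxiliary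

/-- Theorem 5.9 of the paper (error bound ad infinitum for the GSG over a ball):
with `[Tₙ]ᵢ = ∫_{Bₙ(0;r)} xᵢ·(f(x⁰+x)−f(x⁰)) dx` and
`η = Γ((n+4)/2)/(√π·Γ((n+3)/2))`, one has
`‖(2π/V_{n+2})·Tₙ − ∇f(x⁰)‖ ≤ (√n/(3√π))·L_H·η·r²`. -/
theorem error_bound_ad_infinitum_ball
    (n : ℕ) (hn : 1 ≤ n) (r : ℝ) (hr : 0 < r)
    (x0 : EuclideanSpace ℝ (Fin n))
    (f : EuclideanSpace ℝ (Fin n) → ℝ)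
    (U : Set (EuclideanSpace ℝ (Fin n))) (hU : IsOpen U)
    (hsub : Metric.closedBall x0 r ⊆ U)
    (hf : ContDiffOn ℝ 3 f U)
    (LH : NNReal)
    (hlip : LipschitzOnWith LH (fun x => fderiv ℝ (gradient f) x)
      (Metric.closedBall x0 r)) :
    ‖vecE (fun i => (2 * Real.pi / Vnp2 n r) *
        ∫ x in Metric.closedBall (0 : EuclideanSpace ℝ (Fin n)) r,
          x i * (f (x0 + x) - f x0))
      - gradient f x0‖
      ≤ (Real.sqrt n / (3 * Real.sqrt Real.pi)) * (LH : ℝ)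
          * (Real.Gamma (((n : ℝ) + 4) / 2)
              / (Real.sqrt Real.pi * Real.Gamma (((n : ℝ) + 3) / 2)))
          * r ^ 2 := by
  have : Nonempty (Fin n) := ⟨⟨0, hn⟩⟩
  have hf2 : ContDiffOn ℝ 2 f U := hf.of_le (by norm_num)
  have hfc := continuousOn_sub_center hf.continuousOn hsub
  have h := norm_smul_setIntegral_sub_gradient_le hU hf2 hr hsub hlip
  rw [finrank_euclideanSpace_fin] at h
  rw [vecE_mul_setIntegral _ (ContinuousOn.integrableOn_compact (isCompact_closedBall 0 r)
    (hfc.fun_smul continuousOn_id)), two_pi_div_Vnp2 hn hr]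
  refine h.trans ?_
  calc √(n : ℝ) / 3 * LH * (((n : ℝ) + 2) / (2 * (n + 4))) * r ^ 2
      ≤ √(n : ℝ) / 3 * LH * (Real.Gamma (((n : ℝ) + 4) / 2) /
          (Real.pi * Real.Gamma (((n : ℝ) + 3) / 2))) * r ^ 2 := by
        gcongr ?_ * ?_
        exact mul_le_mul_of_nonneg_left (gamma_ratio_lower n) (by positivity)
    _ = _ := by
        nth_rw 1 [← Real.mul_self_sqrt Real.pi_pos.le]
        ring

end
end
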